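/- Let α > β > 2 and suppose that for every two-dimensional lattice L of co-volume 1 that is not the image of A₂ under an orthogonal transformation of ℝ², one has ζ_L(α) − ζ_{A₂}(α) > (α/β)·(ζ_L(β) − ζ_{A₂}(β)). Then for all a, b > 0, for f(r) = a r^{-α} - b r^{-β}, and for every V with 0 < V ≤ (a α/(b β))^{2/(α-β)}, the triangular lattice √V·A₂ is the unique minimizer of E_f among lattices of co-volume V, up to rotation: E_f[L] ≥ E_f[√V·A₂] for all lattices L of co-volume V, with equality iff L = O·(√V·A₂) for some orthogonal O. -/

import Mathlib

open scoped Pointwise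

noncomputable section

/-- A point of the Euclidean plane with coordinates `a`, `b`. -/
def vec2 (a b : ℝ) : EuclideanSpace ℝ (Fin 2) := (WithLp.equiv 2 (Fin 2 → ℝ)).symm ![a, b]

/-- The lattice (as a set of points) generated by `u` and `v`. -/
def latticeSet (u v : EuclideanSpace ℝ (Fin 2)) : Set (EuclideanSpace ℝ (Fin 2)) :=
  {p | ∃ m n : ℤ, p = (m : ℝ) • u + (n : ℝ) • v}

/-- The determinant of the pair of plane vectors `(u, v)`. -/
def det2 (u v : EuclideanSpace ℝ (Fin 2)) : ℝ := u 0 * v 1 - u 1 * v 0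

/-- `L` is a two-dimensional lattice, i.e. `L = ℤu ⊕ ℤv` for a basis `(u,v)` of ℝ². -/
def IsLattice2 (L : Set (EuclideanSpace ℝ (Fin 2))) : Prop :=
  ∃ u v : EuclideanSpace ℝ (Fin 2), det2 u v ≠ 0 ∧ L = latticeSet u v

/-- `L` is a two-dimensional lattice of co-volume `V = |det(u,v)|`. -/
def IsLattice2OfCovol (L : Set (EuclideanSpace ℝ (Fin 2))) (V : ℝ) : Prop :=
  ∃ u v : EuclideanSpace ℝ (Fin 2), det2 u v ≠ 0 ∧ |det2 u v| = V ∧ L = latticeSet u v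

/-- The Epstein zeta function of a set of points: `ζ_L(s) = Σ'_{p ∈ L, p ≠ 0} |p|^{-s}`. -/
def epsteinZeta (L : Set (EuclideanSpace ℝ (Fin 2))) (s : ℝ) : ℝ :=
  ∑' p : ↥(L \ {0}), ‖(p : EuclideanSpace ℝ (Fin 2))‖ ^ (-s)

/-- The Lennard-Jones type energy `E_f[L] = Σ'_{p ∈ L, p ≠ 0} (a|p|^{-α} - b|p|^{-β})`. -/
def LJenergy (a b α β : ℝ) (L : Set (EuclideanSpace ℝ (Fin 2))) : ℝ :=
  ∑' p : ↥(L \ {0}),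
    (a * ‖(p : EuclideanSpace ℝ (Fin 2))‖ ^ (-α) - b * ‖(p : EuclideanSpace ℝ (Fin 2))‖ ^ (-β))

/-- The triangular lattice `A₂ = √(2/√3)·[ℤ(1,0) ⊕ ℤ(1/2,√3/2)]`, of co-volume 1. -/
def triangularLattice : Set (EuclideanSpace ℝ (Fin 2)) :=
  latticeSet (Real.sqrt (2 / Real.sqrt 3) • vec2 1 0)
    (Real.sqrt (2 / Real.sqrt 3) • vec2 (1 / 2) (Real.sqrt 3 / 2))

/-- The square lattice `ℤ² = ℤ(1,0) ⊕ ℤ(0,1)`. -/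
def squareLattice : Set (EuclideanSpace ℝ (Fin 2)) := latticeSet (vec2 1 0) (vec2 0 1)

/-- `L` is the image of `L'` under an orthogonal transformation of ℝ². -/
def IsRotationOf (L L' : Set (EuclideanSpace ℝ (Fin 2))) : Prop :=
  ∃ O : EuclideanSpace ℝ (Fin 2) ≃ₗᵢ[ℝ] EuclideanSpace ℝ (Fin 2), L = O '' L'

/-- The unit co-volume lattice parametrized by `(x, y)` in the half-fundamental domain:
`ℤu ⊕ ℤv` with `u = (1/√y, 0)` and `v = (x/√y, √y)`. -/
def latticeXY (x y : ℝ) : Set (EuclideanSpace ℝ (Fin 2)) :=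
  latticeSet (vec2 (1 / Real.sqrt y) 0) (vec2 (x / Real.sqrt y) (Real.sqrt y))

/-- The Riemann zeta function `ζ(s) = Σ_{m ≥ 1} m^{-s}` (real variable version). -/
def riemannZetaReal (s : ℝ) : ℝ := ∑' n : ℕ+, (n : ℝ) ^ (-s)

end

/-- The binary quadratic form `A m² + B m n + D n²` on `ℤ²`. -/
def quadForm (A B D : ℝ) (p : ℤ × ℤ) : ℝ := A * p.1 ^ 2 + B * p.1 * p.2 + D * p.2 ^ 2

/-- The theta series `∑ exp (-τ Q(p))` of the form `Q = A m² + B m n + D n²`. -/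
noncomputable def formTheta (A B D τ : ℝ) : ℝ := ∑' p : ℤ × ℤ, Real.exp (-(τ * quadForm A B D p))

theorem pade_le_exp_neg {u : ℝ} (hu : 0 ≤ u) :
    6 - 2 * u ≤ (6 + 4 * u + u ^ 2) * Real.exp (-u) := by
  have hd : ∀ x : ℝ, HasDerivAt (fun x : ℝ => (6 + 4 * x + x ^ 2) * Real.exp (-x) + 2 * x)
      (2 - (2 + 2 * x + x ^ 2) * Real.exp (-x)) x := by
    intro x
    have h1 : HasDerivAt (fun x : ℝ => 6 + 4 * x + x ^ 2) (4 + 2 * x) x := by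
      have := (((hasDerivAt_id x).const_mul 4).const_add 6).add ((hasDerivAt_id x).pow 2)
      refine this.congr_deriv ?_
      simp
    have h2 : HasDerivAt (fun x : ℝ => Real.exp (-x)) (Real.exp (-x) * -1) x :=
      (hasDerivAt_neg x).exp
    refine ((h1.mul h2).add ((hasDerivAt_id x).const_mul 2)).congr_deriv ?_
    ring
  have hmono : MonotoneOn (fun x : ℝ => (6 + 4 * x + x ^ 2) * Real.exp (-x) + 2 * x)
      (Set.Ici 0) := by
    refine monotoneOn_of_deriv_nonneg (convex_Ici 0)
      (fun x _ => (hd x).continuousAt.continuousWithinAt)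
      (fun x _ => (hd x).differentiableAt.differentiableWithinAt) ?_
    intro x hx
    rw [interior_Ici] at hx
    rw [(hd x).deriv]
    have h := Real.quadratic_le_exp_of_nonneg (le_of_lt hx)
    have he := Real.exp_pos (-x)
    have h1 : Real.exp x * Real.exp (-x) = 1 := by rw [← Real.exp_add]; simp
    nlinarith
  have := hmono (Set.mem_Ici.2 le_rfl) (Set.mem_Ici.2 hu) hu
  simp at this
  linarith

theorem quadratic_le_exp_of_neg_le {M v : ℝ} (hM : 0 ≤ M) (hv : -M ≤ v) :
    1 + v + (3 + M) / (6 + 4 * M + M ^ 2) * v ^ 2 ≤ Real.exp v := by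
  have hpos : 0 < 6 + 4 * M + M ^ 2 := by positivity
  rcases le_total 0 v with h | h
  · have h1 := Real.quadratic_le_exp_of_nonneg h
    have h2 : (3 + M) / (6 + 4 * M + M ^ 2) ≤ 1 / 2 := by
      rw [div_le_div_iff₀ hpos two_pos]
      nlinarith
    nlinarith [sq_nonneg v]
  · obtain ⟨u, rfl⟩ : ∃ u, v = -u := ⟨-v, by simp⟩
    have hu : 0 ≤ u := by linarith
    have huM : u ≤ M := by linarith
    have hp : 0 < 6 + 4 * u + u ^ 2 := by positivity
    have h1 := pade_le_exp_neg hu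
    have h2 : (3 + M) / (6 + 4 * M + M ^ 2) ≤ (3 + u) / (6 + 4 * u + u ^ 2) := by
      rw [div_le_div_iff₀ hpos hp]
      nlinarith [mul_nonneg hu hM, mul_nonneg (mul_nonneg hu hM) (sub_nonneg.2 huM),
        mul_nonneg (sub_nonneg.2 huM) (add_nonneg hu hM)]
    have h3 : 1 - u + (3 + u) / (6 + 4 * u + u ^ 2) * u ^ 2 ≤ Real.exp (-u) := by
      have : 1 - u + (3 + u) / (6 + 4 * u + u ^ 2) * u ^ 2
          = (6 - 2 * u) / (6 + 4 * u + u ^ 2) := by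
        field_simp
        ring
      rw [this, div_le_iff₀ hp]
      linarith
    nlinarith [sq_nonneg u]

/-- The three values of a positive form of discriminant `-3` on a hexagonal orbit, for `C` not too
large. -/
theorem three_le_sum_exp {q₁ q₂ q₃ C : ℝ} (hC1 : 1 ≤ C) (hC : C ≤ 43 / 36)
    (hs : q₁ + q₂ + q₃ = 3 * C) (hs2 : q₁ ^ 2 + q₂ ^ 2 + q₃ ^ 2 = 9 / 2 * C ^ 2 - 3 / 2) :
    3 ≤ Real.exp (3.6 * (1 - q₁)) + Real.exp (3.6 * (1 - q₂)) + Real.exp (3.6 * (1 - q₃)) := by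
  set S := Real.sqrt (C ^ 2 - 1) with hS
  have hS0 : 0 ≤ S := Real.sqrt_nonneg _
  have hS2 : S ^ 2 = C ^ 2 - 1 := Real.sq_sqrt (by nlinarith)
  set a := C + S - 1 with ha
  have ha0 : 0 ≤ a := by linarith
  have hSle : S ≤ 0.654 := by nlinarith
  have ha1 : a ≤ 0.85 := by rw [ha]; linarith
  have haC : 2 * (C - 1) * (1 + a) = a ^ 2 := by rw [ha]; nlinarith
  have hq : ∀ x y z : ℝ, x + y + z = 3 * C → x ^ 2 + y ^ 2 + z ^ 2 = 9 / 2 * C ^ 2 - 3 / 2 →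
      -(3.6 * a) ≤ 3.6 * (1 - x) := by
    intro x y z h1 h2
    obtain rfl : z = 3 * C - x - y := by linarith
    have : (x - C) ^ 2 ≤ S ^ 2 := by nlinarith [sq_nonneg (y - (3 * C - x - y))]
    have := abs_le_of_sq_le_sq' this hS0
    linarith [this.2]
  have e1 := quadratic_le_exp_of_neg_le (by positivity) (hq q₁ q₂ q₃ hs hs2)
  have e2 := quadratic_le_exp_of_neg_le (M := 3.6 * a) (by positivity)
    (hq q₂ q₃ q₁ (by linarith) (by linarith))
  have e3 := quadratic_le_exp_of_neg_le (M := 3.6 * a) (by positivity)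
    (hq q₃ q₁ q₂ (by linarith) (by linarith))
  set κ := (3 + 3.6 * a) / (6 + 4 * (3.6 * a) + (3.6 * a) ^ 2) with hκ
  have hκ1 : 1 ≤ κ * (3.6 * (1 + 1.5 * (C - 1))) := by
    have hp : 0 < 6 + 4 * (3.6 * a) + (3.6 * a) ^ 2 := by positivity
    have ha' : 0 < 1 + a := by linarith
    have hC' : C - 1 = a ^ 2 / (2 * (1 + a)) := by
      field_simp
      linarith
    rw [hκ, hC', div_mul_eq_mul_div, le_div_iff₀ hp, ← sub_nonneg]
    have : (3 + 3.6 * a) * (3.6 * (1 + 1.5 * (a ^ 2 / (2 * (1 + a)))))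
        - 1 * (6 + 4 * (3.6 * a) + (3.6 * a) ^ 2)
        = (4.8 + 3.36 * a - 6.3 * a ^ 2 - 3.24 * a ^ 3) / (1 + a) := by
      field_simp
      ring
    rw [this]
    apply div_nonneg _ ha'.le
    nlinarith [mul_nonneg ha0 ha0, mul_nonneg (mul_nonneg ha0 ha0) (sub_nonneg.2 ha1),
      mul_nonneg ha0 (sub_nonneg.2 ha1)]
  have hsum : κ * ((3.6 * (1 - q₁)) ^ 2 + (3.6 * (1 - q₂)) ^ 2 + (3.6 * (1 - q₃)) ^ 2)
      = 3 * 3.6 * (C - 1) * (κ * (3.6 * (1 + 1.5 * (C - 1)))) := by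
    have : (3.6 * (1 - q₁)) ^ 2 + (3.6 * (1 - q₂)) ^ 2 + (3.6 * (1 - q₃)) ^ 2
        = 3 * 3.6 * (C - 1) * (3.6 * (1 + 1.5 * (C - 1))) := by
      linear_combination 3.6 ^ 2 * hs2 - 2 * 3.6 ^ 2 * hs
    rw [this]
    ring
  have : 3 * 3.6 * (C - 1) ≤ 3 * 3.6 * (C - 1) * (κ * (3.6 * (1 + 1.5 * (C - 1)))) :=
    le_mul_of_one_le_right (by linarith) hκ1
  linarith

theorem three_le_sum_exp_of_le {q₁ q₂ q₃ C k : ℝ} (hC1 : 1 ≤ C) (hC : C ≤ 43 / 36)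
    (hs : q₁ + q₂ + q₃ = 3 * C) (hs2 : q₁ ^ 2 + q₂ ^ 2 + q₃ ^ 2 = 9 / 2 * C ^ 2 - 3 / 2)
    (hk : 3.6 ≤ k) :
    3 ≤ Real.exp (k * (1 - q₁)) + Real.exp (k * (1 - q₂)) + Real.exp (k * (1 - q₃)) := by
  have h := three_le_sum_exp hC1 hC hs hs2
  have hb : ∀ x : ℝ, 1 + k / 3.6 * (Real.exp (3.6 * x) - 1) ≤ Real.exp (k * x) := by
    intro x
    have h1 := one_add_mul_self_le_rpow_one_add (s := Real.exp (3.6 * x) - 1)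
      (by linarith [Real.exp_pos (3.6 * x)]) (p := k / 3.6) (by rw [le_div_iff₀] <;> linarith)
    rw [add_sub_cancel, ← Real.exp_mul] at h1
    convert h1 using 2
    ring
  have h1 := hb (1 - q₁)
  have h2 := hb (1 - q₂)
  have h3 := hb (1 - q₃)
  have hk' : 0 ≤ k / 3.6 := by positivity
  nlinarith

theorem quadForm_lower_bound {A B D : ℝ} (hA : 0 < A) (hdisc : 4 * A * D - B ^ 2 = 3) :
    ∃ c : ℝ, 0 < c ∧ ∀ p : ℤ × ℤ, c * ((p.1 : ℝ) ^ 2 + (p.2 : ℝ) ^ 2) ≤ quadForm A B D p := by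
  have hD : 0 < D := by
    by_contra h
    nlinarith [sq_nonneg B]
  refine ⟨3 / (4 * (A + D)), by positivity, fun p => ?_⟩
  rw [div_mul_eq_mul_div, div_le_iff₀ (by positivity)]
  unfold quadForm
  have h1 := sq_nonneg (2 * A * p.1 + B * p.2)
  have h2 := sq_nonneg (B * p.1 + 2 * D * p.2)
  have h3 : (A * p.1 ^ 2 + B * p.1 * p.2 + D * p.2 ^ 2) * (4 * (A + D))
      - 3 * ((p.1 : ℝ) ^ 2 + (p.2 : ℝ) ^ 2)
      = (2 * A * p.1 + B * p.2) ^ 2 + (B * p.1 + 2 * D * p.2) ^ 2 := by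
    linear_combination ((p.1 : ℝ) ^ 2 + (p.2 : ℝ) ^ 2) * hdisc
  linarith

theorem quadForm_pos {A B D : ℝ} (hA : 0 < A) (hdisc : 4 * A * D - B ^ 2 = 3) {p : ℤ × ℤ}
    (hp : p ≠ 0) : 0 < quadForm A B D p := by
  obtain ⟨c, hc, h⟩ := quadForm_lower_bound hA hdisc
  refine lt_of_lt_of_le (mul_pos hc ?_) (h p)
  have : p.1 ≠ 0 ∨ p.2 ≠ 0 := by
    by_contra! hh
    exact hp (Prod.ext hh.1 hh.2)
  rcases this with h | h
  · have : (0 : ℝ) < (p.1 : ℝ) ^ 2 := by positivity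
    positivity
  · have : (0 : ℝ) < (p.2 : ℝ) ^ 2 := by positivity
    positivity

theorem summable_exp_neg_mul_sq_int {c : ℝ} (hc : 0 < c) :
    Summable fun n : ℤ => Real.exp (-(c * (n : ℝ) ^ 2)) := by
  refine (summable_pow_mul_jacobiTheta₂_term_bound 0 (div_pos hc Real.pi_pos) 0).congr fun n => ?_
  rw [pow_zero, one_mul]
  congr 1
  have := Real.pi_ne_zero
  field_simp
  ring

theorem summable_exp_neg_quadForm {A B D τ : ℝ} (hA : 0 < A) (hdisc : 4 * A * D - B ^ 2 = 3)
    (hτ : 0 < τ) : Summable fun p : ℤ × ℤ => Real.exp (-(τ * quadForm A B D p)) := by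
  obtain ⟨c, hc, h⟩ := quadForm_lower_bound hA hdisc
  have hs := summable_exp_neg_mul_sq_int (mul_pos hτ hc)
  have hs2 := hs.mul_of_nonneg hs (fun _ => (Real.exp_pos _).le) (fun _ => (Real.exp_pos _).le)
  refine Summable.of_nonneg_of_le (fun _ => (Real.exp_pos _).le) (fun p => ?_) hs2
  rw [← Real.exp_add]
  apply Real.exp_le_exp.2
  have := mul_le_mul_of_nonneg_left (h p) hτ.le
  linarith

/-- Rotation by `π / 3` of the hexagonal lattice, in coordinates. -/
def hexRotation : Equiv.Perm (ℤ × ℤ) where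
  toFun p := (-p.2, p.1 + p.2)
  invFun p := (p.1 + p.2, -p.1)
  left_inv p := by ext <;> simp
  right_inv p := by ext <;> simp

theorem quadForm_one_hexRotation (p : ℤ × ℤ) :
    quadForm 1 1 1 (hexRotation p) = quadForm 1 1 1 p := by
  simp only [quadForm, hexRotation, Equiv.coe_fn_mk]
  push_cast
  ring

theorem one_le_quadForm_one {p : ℤ × ℤ} (hp : p ≠ 0) : 1 ≤ quadForm 1 1 1 p := by
  have h := quadForm_pos (A := 1) (B := 1) (D := 1) one_pos (by norm_num) hp
  have he : quadForm 1 1 1 p = ((p.1 ^ 2 + p.1 * p.2 + p.2 ^ 2 : ℤ) : ℝ) := by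
    simp [quadForm]
  rw [he] at h ⊢
  exact_mod_cast h

theorem formTheta_one_le_of_two_thirds_le {A B D τ : ℝ} (hA : 2 / 3 ≤ A) (hB : 0 ≤ B)
    (hBA : B ≤ A) (hAD : A ≤ D) (hdisc : 4 * A * D - B ^ 2 = 3) (hτ : 3.6 ≤ τ) :
    formTheta 1 1 1 τ ≤ formTheta A B D τ := by
  have hA0 : 0 < A := by linarith
  have hτ0 : 0 < τ := by linarith
  obtain ⟨C, hC⟩ : ∃ C, C = (2 * A + 2 * D - B) / 3 := ⟨_, rfl⟩
  have hA1 : A ≤ 1 := by nlinarith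
  have hC1 : 1 ≤ C := by
    rw [hC, le_div_iff₀ three_pos]
    nlinarith [sq_nonneg (A - D), sq_nonneg (A + D - 2 * B)]
  have hC2 : C ≤ 43 / 36 := by
    rw [hC, div_le_iff₀ three_pos]
    have hD : D = (3 + B ^ 2) / (4 * A) := by
      field_simp
      linarith
    have : 2 * D ≤ 43 / 12 - 2 * A + B := by
      rw [hD, ← mul_div_assoc, div_le_iff₀ (by positivity)]
      nlinarith [mul_nonneg (sub_nonneg.2 hA) (sub_nonneg.2 hA1), mul_nonneg hB (sub_nonneg.2 hBA)]
    linarith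
  have hsum := summable_exp_neg_quadForm hA0 hdisc hτ0
  set F := fun p : ℤ × ℤ => Real.exp (-(τ * quadForm A B D p)) with hF
  have hsum1 : Summable fun p => F (hexRotation p) := hexRotation.summable_iff.2 hsum
  have hsum2 : Summable fun p => F (hexRotation (hexRotation p)) := hexRotation.summable_iff.2 hsum1
  have ht1 : ∑' p, F (hexRotation p) = ∑' p, F p := hexRotation.tsum_eq F
  have ht2 : ∑' p, F (hexRotation (hexRotation p)) = ∑' p, F p :=
    (hexRotation.tsum_eq fun p => F (hexRotation p)).trans ht1
  have hH := summable_exp_neg_quadForm (A := 1) (B := 1) (D := 1) one_pos (by norm_num) hτ0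
  have hkey : ∀ p : ℤ × ℤ, 3 * Real.exp (-(τ * quadForm 1 1 1 p)) ≤
      F p + F (hexRotation p) + F (hexRotation (hexRotation p)) := by
    intro p
    by_cases hp : p = 0
    · subst hp
      simp [hF, quadForm, hexRotation]
      norm_num
    have hN := one_le_quadForm_one hp
    obtain ⟨N, hNdef⟩ : ∃ N, N = quadForm 1 1 1 p := ⟨_, rfl⟩
    rw [← hNdef] at hN ⊢
    have hN0 : N ≠ 0 := by positivity
    have hq : ∀ x, F x = Real.exp (-(τ * N)) *
        Real.exp (τ * N * (1 - quadForm A B D x / N)) := by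
      intro x
      rw [hF, ← Real.exp_add]
      field_simp
      ring_nf
    have h3 := three_le_sum_exp_of_le (q₁ := quadForm A B D p / N)
      (q₂ := quadForm A B D (hexRotation p) / N)
      (q₃ := quadForm A B D (hexRotation (hexRotation p)) / N) (k := τ * N) hC1 hC2
      (by
        field_simp
        rw [hNdef, hC]
        simp only [quadForm, hexRotation, Equiv.coe_fn_mk]
        push_cast
        ring)
      (by
        field_simp
        rw [hNdef, hC]
        simp only [quadForm, hexRotation, Equiv.coe_fn_mk]
        push_cast
        linear_combination (-(((p.1 : ℝ) ^ 2 + p.1 * p.2 + (p.2 : ℝ) ^ 2) ^ 2)) * hdisc)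
      (by nlinarith)
    rw [hq p, hq (hexRotation p), hq (hexRotation (hexRotation p))]
    have := mul_le_mul_of_nonneg_left h3 (Real.exp_pos (-(τ * N))).le
    linarith
  have := (hH.mul_left 3).tsum_le_tsum hkey ((hsum.add hsum1).add hsum2)
  rw [tsum_mul_left, (hsum.add hsum1).tsum_add hsum2, hsum.tsum_add hsum1, ht1, ht2] at this
  change ∑' p, Real.exp (-(τ * quadForm 1 1 1 p)) ≤ ∑' p, F p
  linarith

theorem hasSum_int_pow_of_le {q : ℝ} (hq0 : 0 ≤ q) (hq1 : q < 1) (k : ℕ) :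
    HasSum (fun n : ℤ => if (k : ℤ) ≤ n then q ^ n.toNat else 0) (q ^ k / (1 - q)) := by
  have hinj : Function.Injective (fun j : ℕ => (j : ℤ) + k) := fun a b h => by simpa using h
  rw [← hinj.hasSum_iff]
  · have := (hasSum_geometric_of_lt_one hq0 hq1).mul_left (q ^ k)
    rw [← div_eq_mul_inv] at this
    convert! this using 1
    ext j
    dsimp only [Function.comp]
    have : ((j : ℤ) + k).toNat = k + j := by omega
    simp [this, pow_add]
  · intro n hn
    rw [if_neg]
    intro h
    exact hn ⟨(n - k).toNat, by dsimp only; omega⟩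

theorem ite_pow_nonneg {q : ℝ} (hq0 : 0 ≤ q) (k : ℕ) (n : ℤ) :
    0 ≤ if (k : ℤ) ≤ n then q ^ n.toNat else 0 := by
  split_ifs
  · exact pow_nonneg hq0 _
  · exact le_rfl

theorem exists_hexRotation_pow_mem_sector {p : ℤ × ℤ} (hp : p ≠ 0) :
    ∃ i ∈ Finset.range 6, 1 ≤ ((hexRotation ^ i) p).1 ∧ 0 ≤ ((hexRotation ^ i) p).2 := by
  have hcase : (1 ≤ p.1 ∧ 0 ≤ p.2) ∨ (1 ≤ -p.2 ∧ 0 ≤ p.1 + p.2) ∨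
      (1 ≤ -(p.1 + p.2) ∧ 0 ≤ p.1) ∨ (1 ≤ -p.1 ∧ 0 ≤ -p.2) ∨ (1 ≤ p.2 ∧ 0 ≤ -(p.1 + p.2)) ∨
      (1 ≤ p.1 + p.2 ∧ 0 ≤ -p.1) := by
    have : p.1 ≠ 0 ∨ p.2 ≠ 0 := by
      by_contra! hh
      exact hp (Prod.ext hh.1 hh.2)
    omega
  have hs : ∀ (i : ℕ) (x y : ℤ), (hexRotation ^ (i + 1)) (x, y) = (hexRotation ^ i) (-y, x + y) :=
    fun i x y => by rw [pow_succ, Equiv.Perm.mul_apply]; rfl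
  have h0 : ∀ x y : ℤ, (hexRotation ^ 0) (x, y) = (x, y) := fun x y => rfl
  obtain ⟨x, y⟩ := p
  rcases hcase with h | h | h | h | h | h
  · exact ⟨0, by simp, by rw [h0]; omega⟩
  · exact ⟨1, by simp, by rw [hs, h0]; omega⟩
  · exact ⟨2, by simp, by rw [hs, hs, h0]; omega⟩
  · exact ⟨3, by simp, by rw [hs, hs, hs, h0]; omega⟩
  · exact ⟨4, by simp, by rw [hs, hs, hs, hs, h0]; omega⟩
  · exact ⟨5, by simp, by rw [hs, hs, hs, hs, hs, h0]; omega⟩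

theorem tsum_le_of_hexRotation_invariant {F g : ℤ × ℤ → ℝ} {σ : ℝ} (hg0 : ∀ p, 0 ≤ g p)
    (hg : HasSum g σ) (hF : Summable F) (hF0 : F 0 ≤ 1) (hrot : ∀ p, F (hexRotation p) = F p)
    (hbound : ∀ p : ℤ × ℤ, 1 ≤ p.1 → 0 ≤ p.2 → F p ≤ g p) : ∑' p, F p ≤ 1 + 6 * σ := by
  have hs : HasSum (fun p => ∑ i ∈ Finset.range 6, g ((hexRotation ^ i) p))
      (∑ i ∈ Finset.range 6, σ) :=
    hasSum_sum fun i _ => (Equiv.hasSum_iff (hexRotation ^ i : Equiv.Perm (ℤ × ℤ))).2 hg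
  rw [Finset.sum_const, Finset.card_range, nsmul_eq_mul] at hs
  have hpow : ∀ (i : ℕ) p, F ((hexRotation ^ i) p) = F p := by
    intro i
    induction i with
    | zero => exact fun p => rfl
    | succ i ih =>
      intro p
      rw [pow_succ, Equiv.Perm.mul_apply, ih, hrot]
  refine hasSum_le (fun p => ?_) hF.hasSum ((hasSum_ite_eq (0 : ℤ × ℤ) (1 : ℝ)).add hs)
  have hnonneg : 0 ≤ ∑ i ∈ Finset.range 6, g ((hexRotation ^ i) p) :=
    Finset.sum_nonneg fun i _ => hg0 _
  by_cases hp : p = 0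
  · rw [if_pos hp, hp]
    rw [hp] at hnonneg
    linarith
  rw [if_neg hp, zero_add]
  obtain ⟨i, hi, h1, h2⟩ := exists_hexRotation_pow_mem_sector hp
  have := Finset.single_le_sum (f := fun i => g ((hexRotation ^ i) p)) (fun i _ => hg0 _) hi
  exact ((hpow i p).symm.le.trans (hbound _ h1 h2)).trans this

theorem formTheta_one_le_bound {τ : ℝ} (hτ : 0 < τ) :
    formTheta 1 1 1 τ ≤ 1 + 6 * (Real.exp (-τ) / (1 - Real.exp (-τ)) *
      (1 / (1 - Real.exp (-τ) ^ 2))) := by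
  obtain ⟨q, hq⟩ : ∃ q, q = Real.exp (-τ) := ⟨_, rfl⟩
  rw [← hq]
  have hq0 : 0 ≤ q := hq ▸ (Real.exp_pos _).le
  have hq1 : q < 1 := hq ▸ Real.exp_lt_one_iff.2 (by linarith)
  have h1 := hasSum_int_pow_of_le hq0 hq1 1
  have h2 := hasSum_int_pow_of_le (sq_nonneg q) (by nlinarith) 0
  rw [pow_one] at h1
  rw [pow_zero] at h2
  have hprod := h1.mul h2 (h1.summable.mul_of_nonneg h2.summable
    (ite_pow_nonneg hq0 1) (ite_pow_nonneg (sq_nonneg q) 0))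
  refine tsum_le_of_hexRotation_invariant (fun p =>
    mul_nonneg (ite_pow_nonneg hq0 1 p.1) (ite_pow_nonneg (sq_nonneg q) 0 p.2)) hprod
    (summable_exp_neg_quadForm (A := 1) (B := 1) (D := 1) one_pos (by norm_num) hτ)
    (by simp [quadForm]) (fun p => by rw [quadForm_one_hexRotation]) ?_
  intro p hp1 hp2
  rw [if_pos (by simpa using hp1), if_pos (by simpa using hp2), ← pow_mul, ← pow_add, hq,
    ← Real.exp_nat_mul]
  apply Real.exp_le_exp.2
  have hi : p.1 + 2 * p.2 ≤ p.1 ^ 2 + p.1 * p.2 + p.2 ^ 2 := by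
    rcases eq_or_lt_of_le hp2 with h | h
    · rw [← h]
      nlinarith
    · nlinarith [mul_nonneg (sub_nonneg.2 hp1) hp2,
        mul_nonneg (sub_nonneg.2 (Int.add_one_le_of_lt h)) hp2]
  have hi' : (p.1 : ℝ) + 2 * p.2 ≤ quadForm 1 1 1 p := by
    simp only [quadForm, one_mul]
    exact_mod_cast hi
  have hc : ((p.1.toNat + 2 * p.2.toNat : ℕ) : ℝ) = (p.1 : ℝ) + 2 * p.2 := by
    have : ((p.1.toNat + 2 * p.2.toNat : ℕ) : ℤ) = p.1 + 2 * p.2 := by omega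
    exact_mod_cast this
  rw [hc]
  nlinarith

theorem formTheta_one_le_of_le_two_thirds {A B D τ : ℝ} (hA0 : 0 < A) (hA : A ≤ 2 / 3)
    (hdisc : 4 * A * D - B ^ 2 = 3) (hτ : 3.6 ≤ τ) :
    formTheta 1 1 1 τ ≤ formTheta A B D τ := by
  have hτ0 : 0 < τ := by linarith
  refine (formTheta_one_le_bound hτ0).trans ?_
  have hlow : 1 + 2 * Real.exp (-(τ * A)) ≤ formTheta A B D τ := by
    have := (summable_exp_neg_quadForm hA0 hdisc hτ0).sum_le_tsum
      ({(0, 0), (1, 0), (-1, 0)} : Finset (ℤ × ℤ)) (fun _ _ => (Real.exp_pos _).le)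
    refine le_trans (le_of_eq ?_) this
    rw [Finset.sum_insert (by simp), Finset.sum_insert (by simp), Finset.sum_singleton]
    simp [quadForm]
    ring
  refine le_trans ?_ hlow
  have he : (3.3 : ℝ) ≤ Real.exp 1.2 := by
    have h1 := Real.exp_one_gt_d9
    have h2 := Real.quadratic_le_exp_of_nonneg (x := 0.2) (by norm_num)
    have : Real.exp 1.2 = Real.exp 1 * Real.exp 0.2 := by rw [← Real.exp_add]; norm_num
    rw [this]
    nlinarith
  have he' : (3.3 : ℝ) ≤ Real.exp (τ / 3) :=
    he.trans (Real.exp_le_exp.2 (by linarith))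
  have hE : Real.exp (τ / 3) * Real.exp (-τ) ≤ Real.exp (-(τ * A)) := by
    rw [← Real.exp_add]
    exact Real.exp_le_exp.2 (by nlinarith)
  have hq : Real.exp (-τ) ≤ 1 / 35 := by
    have : Real.exp (-τ) * Real.exp (τ / 3) ^ 3 = 1 := by
      rw [← Real.exp_nat_mul, ← Real.exp_add]
      simp
      ring
    have h3 : (35 : ℝ) ≤ Real.exp (τ / 3) ^ 3 :=
      le_trans (by norm_num) (pow_le_pow_left₀ (by norm_num) he' 3)
    have := Real.exp_pos (-τ)
    rw [le_div_iff₀ (by norm_num)]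
    nlinarith
  set q := Real.exp (-τ)
  have hq0 : 0 < q := Real.exp_pos _
  have : q / (1 - q) * (1 / (1 - q ^ 2)) ≤ 1.1 * q := by
    rw [div_mul_div_comm, mul_one, div_le_iff₀ (by apply mul_pos <;> nlinarith)]
    have : 1 ≤ 1.1 * ((1 - q) * (1 - q ^ 2)) := by nlinarith [pow_pos hq0 3]
    nlinarith
  nlinarith

theorem normSq_intCast_mul_add (z : ℂ) (c d : ℤ) :
    Complex.normSq (c * z + d) = c ^ 2 * Complex.normSq z + 2 * c * d * z.re + d ^ 2 := by
  simp [Complex.normSq_apply]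
  ring

/-- The permutation of `ℤ²` given by an integer matrix with determinant one. -/
def intMatrixPerm (a b c d : ℤ) (h : a * d - b * c = 1) : Equiv.Perm (ℤ × ℤ) where
  toFun p := (p.1 * d + p.2 * b, p.1 * c + p.2 * a)
  invFun p := (a * p.1 - b * p.2, d * p.2 - c * p.1)
  left_inv p := by
    ext
    · linear_combination p.1 * h
    · linear_combination p.2 * h
  right_inv p := by
    ext
    · linear_combination p.1 * h
    · linear_combination p.2 * h

theorem exists_abs_reduced {A B D : ℝ} (hA : 0 < A) (hdisc : 4 * A * D - B ^ 2 = 3) :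
    ∃ (e : Equiv.Perm (ℤ × ℤ)) (A' B' D' : ℝ), 0 < A' ∧ |B'| ≤ A' ∧ A' ≤ D' ∧
      4 * A' * D' - B' ^ 2 = 3 ∧ ∀ p, quadForm A B D (e p) = quadForm A' B' D' p := by
  let z : UpperHalfPlane := ⟨⟨B / (2 * A), Real.sqrt 3 / (2 * A)⟩, by
    change 0 < Real.sqrt 3 / (2 * A)
    positivity⟩
  have hzre : (z : ℂ).re = B / (2 * A) := rfl
  have hzns : Complex.normSq (z : ℂ) = D / A := by
    change Complex.normSq ⟨B / (2 * A), Real.sqrt 3 / (2 * A)⟩ = _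
    rw [Complex.normSq_mk]
    have h3 : Real.sqrt 3 * Real.sqrt 3 = 3 := Real.mul_self_sqrt (by norm_num)
    have : B / (2 * A) * (B / (2 * A)) + Real.sqrt 3 / (2 * A) * (Real.sqrt 3 / (2 * A))
        = (B ^ 2 + Real.sqrt 3 * Real.sqrt 3) / (4 * A ^ 2) := by
      field_simp
      ring
    rw [this, h3]
    field_simp
    linarith
  obtain ⟨g, hg1, hg2⟩ := ModularGroup.exists_smul_mem_fd z
  obtain ⟨a, ha⟩ : ∃ a, a = g 0 0 := ⟨_, rfl⟩
  obtain ⟨b, hb⟩ : ∃ b, b = g 0 1 := ⟨_, rfl⟩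
  obtain ⟨c, hc⟩ : ∃ c, c = g 1 0 := ⟨_, rfl⟩
  obtain ⟨d, hd⟩ : ∃ d, d = g 1 1 := ⟨_, rfl⟩
  have hdet : a * d - b * c = 1 := by
    rw [ha, hb, hc, hd, ← Matrix.det_fin_two, g.det_coe]
  have hdetR : (a : ℝ) * d - b * c = 1 := by exact_mod_cast hdet
  have hw : ((g • z : UpperHalfPlane) : ℂ) = ((a : ℂ) * z + b) / (c * z + d) := by
    rw [UpperHalfPlane.specialLinearGroup_apply, ha, hb, hc, hd]
    simp
  have hA'pos : 0 < quadForm A B D (d, c) := by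
    apply quadForm_pos hA hdisc
    intro h
    have h1 : d = 0 := congrArg Prod.fst h
    have h2 : c = 0 := congrArg Prod.snd h
    rw [h1, h2] at hdet
    simp at hdet
  have hden : Complex.normSq (c * (z : ℂ) + d) = quadForm A B D (d, c) / A := by
    rw [normSq_intCast_mul_add, hzre, hzns]
    simp only [quadForm]
    field_simp
    ring
  have hnum : Complex.normSq (a * (z : ℂ) + b) = quadForm A B D (b, a) / A := by
    rw [normSq_intCast_mul_add, hzre, hzns]
    simp only [quadForm]
    field_simp
    ring
  refine ⟨intMatrixPerm a b c d hdet, quadForm A B D (d, c),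
    2 * A * d * b + B * (d * a + b * c) + 2 * D * c * a, quadForm A B D (b, a), hA'pos, ?_, ?_, ?_,
    ?_⟩
  · have hre : (g • z : UpperHalfPlane).re =
        (2 * A * d * b + B * (d * a + b * c) + 2 * D * c * a) / (2 * quadForm A B D (d, c)) := by
      rw [← UpperHalfPlane.coe_re, hw, Complex.div_re, hden, ← add_div]
      have : (a * (z : ℂ) + b).re * (c * (z : ℂ) + d).re + (a * (z : ℂ) + b).im *
          (c * (z : ℂ) + d).im
          = a * c * Complex.normSq z + (a * d + b * c) * (z : ℂ).re + b * d := by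
        simp [Complex.normSq_apply]
        ring
      rw [this, hzre, hzns]
      field_simp
      ring
    rw [hre, abs_div, abs_of_pos (a := 2 * quadForm A B D (d, c)) (by positivity),
      div_le_div_iff₀ (by positivity) two_pos] at hg2
    linarith
  · rw [hw, Complex.normSq_div, hden, hnum, div_div_div_cancel_right₀ hA.ne',
      one_le_div hA'pos] at hg1
    exact hg1
  · simp only [quadForm]
    linear_combination (a * d - b * c : ℝ) ^ 2 * hdisc + 3 * (a * d - b * c + 1) * hdetR
  · intro p
    simp only [quadForm, intMatrixPerm, Equiv.coe_fn_mk]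
    push_cast
    ring

/-- The permutation `(m, n) ↦ (m, -n)` of `ℤ²`. -/
def negSndPerm : Equiv.Perm (ℤ × ℤ) := (Equiv.refl ℤ).prodCongr (Equiv.neg ℤ)

theorem quadForm_negSndPerm (A B D : ℝ) (p : ℤ × ℤ) :
    quadForm A B D (negSndPerm p) = quadForm A (-B) D p := by
  simp [quadForm, negSndPerm]

theorem formTheta_neg (A B D τ : ℝ) : formTheta A (-B) D τ = formTheta A B D τ := by
  unfold formTheta
  rw [← negSndPerm.tsum_eq]
  simp_rw [quadForm_negSndPerm, neg_neg]

theorem formTheta_one_le_of_le {A B D τ : ℝ} (hA : 0 < A) (hdisc : 4 * A * D - B ^ 2 = 3)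
    (hτ : 3.6 ≤ τ) : formTheta 1 1 1 τ ≤ formTheta A B D τ := by
  obtain ⟨e, A', B', D', hA', hB', hAD, hd', he⟩ := exists_abs_reduced hA hdisc
  have h1 : formTheta A B D τ = formTheta A' |B'| D' τ := by
    have : formTheta A B D τ = formTheta A' B' D' τ := by
      unfold formTheta
      rw [← e.tsum_eq]
      simp_rw [he]
    rw [this]
    rcases abs_choice B' with h | h
    · rw [h]
    · rw [h, formTheta_neg]
  rw [h1]
  rw [← sq_abs] at hd'
  rcases le_total A' (2 / 3) with h | h
  · exact formTheta_one_le_of_le_two_thirds hA' h hd' hτ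
  · exact formTheta_one_le_of_two_thirds_le h (abs_nonneg _) hB' hAD hd' hτ

theorem hasSum_exp_formTheta {A B D τ : ℝ} (hA : 0 < A) (hdisc : 4 * A * D - B ^ 2 = 3)
    (hτ : 0 < τ) : HasSum (fun p : ℤ × ℤ => Complex.exp (-(τ * (A * p.1 ^ 2 + B * p.1 * p.2 +
      D * p.2 ^ 2)))) (formTheta A B D τ) := by
  have := Complex.hasSum_ofReal.2 (summable_exp_neg_quadForm hA hdisc hτ).hasSum
  convert! this using 2 with p
  simp [quadForm]

theorem tsum_exp_add_quadratic {a : ℝ} (ha : 0 < a) (b c : ℂ) :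
    ∑' n : ℤ, Complex.exp (c + (-Real.pi * a * n ^ 2 + 2 * Real.pi * b * n)) =
      1 / (a : ℂ) ^ (1 / 2 : ℂ) *
        ∑' n : ℤ, Complex.exp (c + -Real.pi / a * (n + Complex.I * b) ^ 2) := by
  simp_rw [Complex.exp_add c]
  rw [tsum_mul_left, tsum_mul_left, Complex.tsum_exp_neg_quadratic (by rwa [Complex.ofReal_re]),
    mul_left_comm]

theorem formTheta_functional_equation {A B D τ : ℝ} (hA : 0 < A)
    (hdisc : 4 * A * D - B ^ 2 = 3) (hτ : 0 < τ) :
    formTheta A B D τ =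
      2 * Real.pi / (Real.sqrt 3 * τ) * formTheta A B D (4 * Real.pi ^ 2 / (3 * τ)) := by
  have hD : 0 < D := by
    by_contra h
    nlinarith [sq_nonneg B]
  have hpi := Real.pi_pos
  have hpiC : (Real.pi : ℂ) ≠ 0 := by exact_mod_cast hpi.ne'
  have hDC : (D : ℂ) ≠ 0 := by exact_mod_cast hD.ne'
  have hτC : (τ : ℂ) ≠ 0 := by exact_mod_cast hτ.ne'
  have hdC : 4 * (A : ℂ) * D - B ^ 2 = 3 := by exact_mod_cast hdisc
  have hτ' : 0 < 4 * Real.pi ^ 2 / (3 * τ) := by positivity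
  rw [← formTheta_neg A B D (4 * Real.pi ^ 2 / (3 * τ))]
  have H1 := hasSum_exp_formTheta hA hdisc hτ
  have H2 := hasSum_exp_formTheta (B := -B) hA (by rw [neg_sq]; exact hdisc) hτ'
  set K : ℤ → ℤ → ℂ := fun m k => Complex.exp (-((Real.pi ^ 2 / (τ * D) : ℝ) * k ^ 2) +
    Complex.I * Real.pi * B * m * k / D - (3 * τ / (4 * D) : ℝ) * m ^ 2) with hK
  have hKs : Summable (Function.uncurry K) := by
    have s1 := summable_exp_neg_mul_sq_int (c := Real.pi ^ 2 / (τ * D)) (by positivity)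
    have s2 := summable_exp_neg_mul_sq_int (c := 3 * τ / (4 * D)) (by positivity)
    refine Summable.of_norm ((s2.mul_of_nonneg s1 (fun _ => (Real.exp_pos _).le)
      (fun _ => (Real.exp_pos _).le)).congr fun p => ?_)
    rw [Function.uncurry, hK, Complex.norm_exp, ← Real.exp_add]
    congr 1
    have : (-((Real.pi ^ 2 / (τ * D) : ℝ) * (p.2 : ℂ) ^ 2) +
        Complex.I * Real.pi * B * p.1 * p.2 / D - (3 * τ / (4 * D) : ℝ) * (p.1 : ℂ) ^ 2)
        = ((-(Real.pi ^ 2 / (τ * D) * (p.2 : ℝ) ^ 2) - 3 * τ / (4 * D) * (p.1 : ℝ) ^ 2 : ℝ) : ℂ)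
          + ((Real.pi * B * p.1 * p.2 / D : ℝ) : ℂ) * Complex.I := by
      push_cast
      ring
    rw [this, Complex.add_re, Complex.re_ofReal_mul, Complex.I_re, Complex.ofReal_re]
    ring
  have hα : 0 < τ * D / Real.pi := by positivity
  have hα' : 0 < 3 * τ / (4 * Real.pi * D) := by positivity
  have E1 : ∀ m : ℤ, ∑' n : ℤ, Complex.exp (-(τ * (A * m ^ 2 + B * m * n + D * n ^ 2))) =
      1 / ((τ * D / Real.pi : ℝ) : ℂ) ^ (1 / 2 : ℂ) * ∑' k : ℤ, K m k := by
    intro m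
    convert! tsum_exp_add_quadratic hα (-(τ * B * m / (2 * Real.pi))) (-(τ * (A * m ^ 2)))
      using 4 with n n
    · push_cast
      field_simp
      ring
    · refine congrArg Complex.exp ?_
      push_cast
      field_simp
      linear_combination (4 * τ ^ 2 * m ^ 2 : ℂ) * hdC + (4 * τ ^ 2 * m ^ 2 * B ^ 2 : ℂ) * Complex.I_sq
  have E2 : ∀ k : ℤ, ∑' m : ℤ, K m k = 1 / ((3 * τ / (4 * Real.pi * D) : ℝ) : ℂ) ^ (1 / 2 : ℂ) *
      ∑' l : ℤ, Complex.exp (-((4 * Real.pi ^ 2 / (3 * τ) : ℝ) *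
        (A * k ^ 2 + (-B : ℝ) * k * l + D * l ^ 2))) := by
    intro k
    convert! tsum_exp_add_quadratic hα' (Complex.I * B * k / (2 * D))
      (-((Real.pi ^ 2 / (τ * D) : ℝ) * k ^ 2)) using 4 with n n
    · push_cast
      field_simp
      ring
    · have : (n + Complex.I * (Complex.I * B * k / (2 * D))) = n - B * k / (2 * D) := by
        linear_combination (B * k / (2 * D) : ℂ) * Complex.I_sq
      rw [this]
      refine congrArg Complex.exp ?_
      push_cast
      field_simp
      linear_combination (-4 * k ^ 2 : ℂ) * hdC
  have hc : (1 / ((τ * D / Real.pi : ℝ) : ℂ) ^ (1 / 2 : ℂ)) *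
      (1 / ((3 * τ / (4 * Real.pi * D) : ℝ) : ℂ) ^ (1 / 2 : ℂ)) =
      ((2 * Real.pi / (Real.sqrt 3 * τ) : ℝ) : ℂ) := by
    have h12 : (1 / 2 : ℂ) = ((1 / 2 : ℝ) : ℂ) := by norm_num
    rw [h12, ← Complex.ofReal_cpow hα.le, ← Complex.ofReal_cpow hα'.le, ← Real.sqrt_eq_rpow,
      ← Real.sqrt_eq_rpow]
    norm_cast
    rw [one_div_mul_one_div, ← Real.sqrt_mul hα.le]
    have : τ * D / Real.pi * (3 * τ / (4 * Real.pi * D)) = 3 * (τ / (2 * Real.pi)) ^ 2 := by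
      field_simp
      ring
    rw [this, Real.sqrt_mul (by norm_num), Real.sqrt_sq (by positivity)]
    field_simp
  have key : ((formTheta A B D τ : ℝ) : ℂ) = ((2 * Real.pi / (Real.sqrt 3 * τ) : ℝ) : ℂ) *
      (formTheta A (-B) D (4 * Real.pi ^ 2 / (3 * τ)) : ℝ) := by
    rw [← H1.tsum_eq, ← H2.tsum_eq, H1.summable.tsum_prod, H2.summable.tsum_prod]
    simp only [E1]
    rw [tsum_mul_left, ← hKs.tsum_comm]
    simp only [E2]
    rw [tsum_mul_left, ← mul_assoc, hc]
  exact_mod_cast key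

theorem formTheta_one_le {A B D τ : ℝ} (hA : 0 < A) (hdisc : 4 * A * D - B ^ 2 = 3)
    (hτ : 0 < τ) : formTheta 1 1 1 τ ≤ formTheta A B D τ := by
  rcases le_total 3.6 τ with h | h
  · exact formTheta_one_le_of_le hA hdisc h
  rw [formTheta_functional_equation hA hdisc hτ,
    formTheta_functional_equation one_pos (by norm_num) hτ]
  refine mul_le_mul_of_nonneg_left (formTheta_one_le_of_le hA hdisc ?_) (by positivity)
  rw [le_div_iff₀ (by positivity)]
  nlinarith [Real.pi_gt_d2]

theorem formTheta_eq_one_add {A B D τ : ℝ} (hA : 0 < A) (hdisc : 4 * A * D - B ^ 2 = 3)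
    (hτ : 0 < τ) : formTheta A B D τ =
      1 + ∑' p : {p : ℤ × ℤ // p ≠ 0}, Real.exp (-(τ * quadForm A B D p)) := by
  have := (summable_exp_neg_quadForm hA hdisc hτ).tsum_subtype_add_tsum_subtype_compl {0}
  rw [formTheta, ← this, tsum_singleton (0 : ℤ × ℤ)
    fun p => Real.exp (-(τ * quadForm A B D p))]
  congr 1
  simp [quadForm]

theorem ofReal_gamma_mul_rpow_eq_lintegral {q s : ℝ} (hq : 0 < q) (hs : 0 < s) :
    ENNReal.ofReal (Real.Gamma s * q ^ (-s)) =
      ∫⁻ τ in Set.Ioi (0 : ℝ), ENNReal.ofReal (τ ^ (s - 1) * Real.exp (-(τ * q))) := by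
  have h := Real.integral_rpow_mul_exp_neg_mul_Ioi hs hq
  have hΓ := Real.Gamma_pos_of_pos hs
  rw [one_div, Real.inv_rpow hq.le, ← Real.rpow_neg hq.le] at h
  simp_rw [mul_comm q] at h
  rw [mul_comm, ← h]
  refine MeasureTheory.ofReal_integral_eq_lintegral_ofReal
    (MeasureTheory.Integrable.of_integral_ne_zero ?_) ?_
  · rw [h]
    positivity
  · filter_upwards [MeasureTheory.ae_restrict_mem measurableSet_Ioi] with τ hτ
    rw [Set.mem_Ioi] at hτ
    dsimp only [Pi.zero_apply]
    positivity

theorem summable_quadForm_rpow {A B D s : ℝ} (hA : 0 < A) (hdisc : 4 * A * D - B ^ 2 = 3)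
    (hs : 1 < s) : Summable fun p : {p : ℤ × ℤ // p ≠ 0} => quadForm A B D p ^ (-s) := by
  obtain ⟨c, hc, hcQ⟩ := quadForm_lower_bound hA hdisc
  have h := EisensteinSeries.summable_one_div_norm_rpow (k := 2 * s) (by linarith)
  rw [← (finTwoArrowEquiv ℤ).symm.summable_iff] at h
  refine Summable.of_nonneg_of_le (fun p => Real.rpow_nonneg (quadForm_pos hA hdisc p.2).le _)
    (fun p => ?_) ((h.mul_left (c ^ (-s))).subtype {p | p ≠ 0})
  obtain ⟨⟨m, n⟩, hp⟩ := p
  change _ ≤ c ^ (-s) * ‖(![m, n] : Fin 2 → ℤ)‖ ^ (-(2 * s))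
  have hx0 : (![m, n] : Fin 2 → ℤ) ≠ 0 := by
    intro h0
    apply hp
    have h1 := congrFun h0 0
    have h2 := congrFun h0 1
    simp at h1 h2
    simp [h1, h2]
  have hpos : 0 < ‖(![m, n] : Fin 2 → ℤ)‖ := norm_pos_iff.2 hx0
  have hle : ‖(![m, n] : Fin 2 → ℤ)‖ ^ 2 ≤ (m : ℝ) ^ 2 + (n : ℝ) ^ 2 := by
    have : ‖(![m, n] : Fin 2 → ℤ)‖ ≤ Real.sqrt ((m : ℝ) ^ 2 + (n : ℝ) ^ 2) := by
      refine (pi_norm_le_iff_of_nonneg (Real.sqrt_nonneg _)).2 fun i => ?_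
      fin_cases i
      · exact Real.abs_le_sqrt (le_add_of_nonneg_right (sq_nonneg (n : ℝ)))
      · exact Real.abs_le_sqrt (le_add_of_nonneg_left (sq_nonneg (m : ℝ)))
    exact (Real.le_sqrt hpos.le (by positivity)).1 this
  have h2 : ‖(![m, n] : Fin 2 → ℤ)‖ ^ (-(2 * s)) = (‖(![m, n] : Fin 2 → ℤ)‖ ^ 2) ^ (-s) := by
    rw [← Real.rpow_natCast, ← Real.rpow_mul hpos.le]
    norm_num
  rw [h2, ← Real.mul_rpow hc.le (by positivity)]
  exact Real.rpow_le_rpow_of_nonpos (by positivity)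
    ((mul_le_mul_of_nonneg_left hle hc.le).trans (hcQ (m, n))) (by linarith)

theorem tsum_quadForm_one_rpow_le {A B D s : ℝ} (hA : 0 < A) (hdisc : 4 * A * D - B ^ 2 = 3)
    (hs : 1 < s) : ∑' p : {p : ℤ × ℤ // p ≠ 0}, quadForm 1 1 1 p ^ (-s) ≤
      ∑' p : {p : ℤ × ℤ // p ≠ 0}, quadForm A B D p ^ (-s) := by
  have hs0 : 0 < s := by linarith
  have hΓ := Real.Gamma_pos_of_pos hs0
  have key : ∀ {A B D : ℝ}, 0 < A → 4 * A * D - B ^ 2 = 3 →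
      ENNReal.ofReal (Real.Gamma s * ∑' p : {p : ℤ × ℤ // p ≠ 0}, quadForm A B D p ^ (-s)) =
        ∫⁻ τ in Set.Ioi (0 : ℝ), ENNReal.ofReal (τ ^ (s - 1) * (formTheta A B D τ - 1)) := by
    intro A B D hA hdisc
    rw [← tsum_mul_left, ENNReal.ofReal_tsum_of_nonneg
      (fun p => mul_nonneg hΓ.le (Real.rpow_nonneg (quadForm_pos hA hdisc p.2).le _))
      ((summable_quadForm_rpow hA hdisc hs).mul_left _)]
    simp_rw [fun p : {p : ℤ × ℤ // p ≠ 0} =>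
      ofReal_gamma_mul_rpow_eq_lintegral (quadForm_pos hA hdisc p.2) hs0]
    rw [← MeasureTheory.lintegral_tsum fun p => by fun_prop]
    refine MeasureTheory.setLIntegral_congr_fun measurableSet_Ioi fun τ hτ => ?_
    rw [Set.mem_Ioi] at hτ
    have hsum : Summable fun p : {p : ℤ × ℤ // p ≠ 0} =>
        τ ^ (s - 1) * Real.exp (-(τ * quadForm A B D p)) :=
      ((summable_exp_neg_quadForm hA hdisc hτ).subtype {p | p ≠ 0}).mul_left _
    rw [formTheta_eq_one_add hA hdisc hτ, add_sub_cancel_left, ← tsum_mul_left,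
      ENNReal.ofReal_tsum_of_nonneg (fun p => by positivity) hsum]
  have hle : ENNReal.ofReal (Real.Gamma s *
        ∑' p : {p : ℤ × ℤ // p ≠ 0}, quadForm 1 1 1 p ^ (-s)) ≤
      ENNReal.ofReal (Real.Gamma s *
        ∑' p : {p : ℤ × ℤ // p ≠ 0}, quadForm A B D p ^ (-s)) := by
    rw [key one_pos (by norm_num), key hA hdisc]
    refine MeasureTheory.setLIntegral_mono' measurableSet_Ioi fun τ hτ => ?_
    rw [Set.mem_Ioi] at hτ
    gcongr
    exact formTheta_one_le hA hdisc hτ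
  rw [ENNReal.ofReal_le_ofReal_iff (mul_nonneg hΓ.le (tsum_nonneg fun p =>
    Real.rpow_nonneg (quadForm_pos hA hdisc p.2).le _))] at hle
  exact le_of_mul_le_mul_left hle hΓ

theorem tsum_image_diff_zero {X Y : Type*} [Zero X] [Zero Y] {φ : X → Y}
    (hφ : Function.Injective φ) (h0 : φ 0 = 0) (S : Set X) (g : Y → ℝ) :
    ∑' y : ↥(φ '' S \ {0}), g y = ∑' x : ↥(S \ {0}), g (φ x) := by
  rw [← tsum_image g hφ.injOn, Set.image_sdiff hφ, Set.image_singleton, h0]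

theorem norm_sq_plane (u : EuclideanSpace ℝ (Fin 2)) : ‖u‖ ^ 2 = u 0 ^ 2 + u 1 ^ 2 := by
  rw [EuclideanSpace.real_norm_sq_eq, Fin.sum_univ_two]

theorem det2_smul_smul (c : ℝ) (u v : EuclideanSpace ℝ (Fin 2)) :
    det2 (c • u) (c • v) = c ^ 2 * det2 u v := by
  simp only [det2, PiLp.smul_apply, smul_eq_mul]
  ring

theorem smul_latticeSet (c : ℝ) (u v : EuclideanSpace ℝ (Fin 2)) :
    c • latticeSet u v = latticeSet (c • u) (c • v) := by
  ext x
  rw [Set.mem_smul_set]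
  constructor
  · rintro ⟨_, ⟨m, n, rfl⟩, rfl⟩
    exact ⟨m, n, by rw [smul_add, smul_comm c, smul_comm c]⟩
  · rintro ⟨m, n, rfl⟩
    exact ⟨_, ⟨m, n, rfl⟩, by rw [smul_add, smul_comm c, smul_comm c]⟩

theorem latticeSet_tsum_eq {u v : EuclideanSpace ℝ (Fin 2)} (h : det2 u v ≠ 0)
    (g : EuclideanSpace ℝ (Fin 2) → ℝ) :
    ∑' x : ↥(latticeSet u v \ {0}), g x =
      ∑' p : {p : ℤ × ℤ // p ≠ 0}, g ((p.1.1 : ℝ) • u + (p.1.2 : ℝ) • v) := by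
  set φ : ℤ × ℤ → EuclideanSpace ℝ (Fin 2) := fun p => (p.1 : ℝ) • u + (p.2 : ℝ) • v with hφ
  have hinj : Function.Injective φ := by
    rintro ⟨m, n⟩ ⟨m', n'⟩ hpq
    have h0 := congrArg (· 0) hpq
    have h1 := congrArg (· 1) hpq
    simp only [hφ, PiLp.add_apply, PiLp.smul_apply, smul_eq_mul] at h0 h1
    unfold det2 at h
    have hm : (m - m' : ℝ) = 0 := mul_right_cancel₀ h (by linear_combination v 1 * h0 - v 0 * h1)
    have hn : (n - n' : ℝ) = 0 := mul_right_cancel₀ h (by linear_combination u 0 * h1 - u 1 * h0)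
    rw [Prod.mk.injEq]
    exact ⟨by exact_mod_cast sub_eq_zero.1 hm, by exact_mod_cast sub_eq_zero.1 hn⟩
  have himg : latticeSet u v = φ '' Set.univ := by
    ext x
    simp [latticeSet, hφ, eq_comm]
  have hset : (Set.univ \ {0} : Set (ℤ × ℤ)) = {p | p ≠ 0} := by
    ext
    simp
  rw [himg, tsum_image_diff_zero hinj (by simp [hφ]), hset]
  rfl

theorem norm_lattice_rpow {u v : EuclideanSpace ℝ (Fin 2)} (s : ℝ) (p : ℤ × ℤ) :
    ‖(p.1 : ℝ) • u + (p.2 : ℝ) • v‖ ^ (-s) =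
      (2 / Real.sqrt 3) ^ (-(s / 2)) * quadForm (Real.sqrt 3 / 2 * (u 0 ^ 2 + u 1 ^ 2))
        (Real.sqrt 3 * (u 0 * v 0 + u 1 * v 1)) (Real.sqrt 3 / 2 * (v 0 ^ 2 + v 1 ^ 2)) p ^
          (-(s / 2)) := by
  have hsq : ‖(p.1 : ℝ) • u + (p.2 : ℝ) • v‖ ^ 2 = 2 / Real.sqrt 3 *
      quadForm (Real.sqrt 3 / 2 * (u 0 ^ 2 + u 1 ^ 2))
        (Real.sqrt 3 * (u 0 * v 0 + u 1 * v 1)) (Real.sqrt 3 / 2 * (v 0 ^ 2 + v 1 ^ 2)) p := by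
    rw [norm_sq_plane]
    simp only [quadForm, PiLp.add_apply, PiLp.smul_apply, smul_eq_mul]
    field_simp
    ring
  have hc : 0 < 2 / Real.sqrt 3 := by positivity
  have hQ := nonneg_of_mul_nonneg_right (hsq ▸ sq_nonneg _) hc
  rw [← Real.mul_rpow hc.le hQ, ← hsq, ← Real.rpow_natCast, ← Real.rpow_mul (norm_nonneg _)]
  congr 1
  push_cast
  ring

theorem quadForm_disc_of_det2 {u v : EuclideanSpace ℝ (Fin 2)} (h : |det2 u v| = 1) :
    0 < Real.sqrt 3 / 2 * (u 0 ^ 2 + u 1 ^ 2) ∧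
      4 * (Real.sqrt 3 / 2 * (u 0 ^ 2 + u 1 ^ 2)) * (Real.sqrt 3 / 2 * (v 0 ^ 2 + v 1 ^ 2)) -
        (Real.sqrt 3 * (u 0 * v 0 + u 1 * v 1)) ^ 2 = 3 := by
  have h3 : Real.sqrt 3 ^ 2 = 3 := Real.sq_sqrt (by norm_num)
  have hd : (u 0 * v 1 - u 1 * v 0) ^ 2 = 1 := by
    rw [← det2, ← sq_abs, h, one_pow]
  constructor
  · by_contra hle
    have hpos : 0 < Real.sqrt 3 / 2 := by positivity
    have h0 : u 0 ^ 2 + u 1 ^ 2 ≤ 0 := by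
      by_contra hlt
      exact hle (mul_pos hpos (not_le.1 hlt))
    have hu0 : u 0 = 0 := by nlinarith [sq_nonneg (u 0), sq_nonneg (u 1)]
    have hu1 : u 1 = 0 := by nlinarith [sq_nonneg (u 0), sq_nonneg (u 1)]
    rw [hu0, hu1] at hd
    norm_num at hd
  · linear_combination (u 0 * v 1 - u 1 * v 0) ^ 2 * h3 + 3 * hd

theorem IsLattice2OfCovol.exists_form {L : Set (EuclideanSpace ℝ (Fin 2))}
    (hL : IsLattice2OfCovol L 1) : ∃ A B D : ℝ, 0 < A ∧ 4 * A * D - B ^ 2 = 3 ∧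
      (∀ s, epsteinZeta L s = (2 / Real.sqrt 3) ^ (-(s / 2)) *
        ∑' p : {p : ℤ × ℤ // p ≠ 0}, quadForm A B D p ^ (-(s / 2))) ∧
      ∀ a b α β, 2 < α → 2 < β →
        LJenergy a b α β L = a * epsteinZeta L α - b * epsteinZeta L β := by
  obtain ⟨u, v, hdet, habs, rfl⟩ := hL
  obtain ⟨hA, hdisc⟩ := quadForm_disc_of_det2 habs
  have hζ : ∀ s, epsteinZeta (latticeSet u v) s = ∑' p : {p : ℤ × ℤ // p ≠ 0},
      ‖(p.1.1 : ℝ) • u + (p.1.2 : ℝ) • v‖ ^ (-s) := fun s =>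
    latticeSet_tsum_eq hdet fun x => ‖x‖ ^ (-s)
  have hsum : ∀ s : ℝ, 2 < s → Summable fun p : {p : ℤ × ℤ // p ≠ 0} =>
      ‖(p.1.1 : ℝ) • u + (p.1.2 : ℝ) • v‖ ^ (-s) := by
    intro s hs
    simp_rw [norm_lattice_rpow]
    exact (summable_quadForm_rpow hA hdisc (by linarith)).mul_left _
  refine ⟨_, _, _, hA, hdisc, fun s => ?_, fun a b α β hα hβ => ?_⟩
  · rw [hζ, ← tsum_mul_left]
    simp_rw [norm_lattice_rpow]
  · rw [hζ, hζ, ← tsum_mul_left, ← tsum_mul_left,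
      ← ((hsum α hα).mul_left a).tsum_sub ((hsum β hβ).mul_left b)]
    exact latticeSet_tsum_eq hdet fun x => a * ‖x‖ ^ (-α) - b * ‖x‖ ^ (-β)

theorem det2_triangular : det2 (Real.sqrt (2 / Real.sqrt 3) • vec2 1 0)
    (Real.sqrt (2 / Real.sqrt 3) • vec2 (1 / 2) (Real.sqrt 3 / 2)) = 1 := by
  rw [det2_smul_smul, Real.sq_sqrt (by positivity)]
  simp [det2, vec2]

theorem isLattice2OfCovol_triangularLattice : IsLattice2OfCovol triangularLattice 1 :=
  ⟨_, _, by rw [det2_triangular]; exact one_ne_zero, by rw [det2_triangular, abs_one], rfl⟩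

theorem epsteinZeta_triangularLattice (s : ℝ) : epsteinZeta triangularLattice s =
    (2 / Real.sqrt 3) ^ (-(s / 2)) *
      ∑' p : {p : ℤ × ℤ // p ≠ 0}, quadForm 1 1 1 p ^ (-(s / 2)) := by
  have h := latticeSet_tsum_eq (by rw [det2_triangular]; exact one_ne_zero) fun x => ‖x‖ ^ (-s)
  simp_rw [norm_lattice_rpow, tsum_mul_left] at h
  rw [epsteinZeta, triangularLattice, h]
  have h3 : Real.sqrt 3 ^ 2 = 3 := Real.sq_sqrt (by norm_num)
  have hc : Real.sqrt (2 / Real.sqrt 3) ^ 2 = 2 / Real.sqrt 3 := Real.sq_sqrt (by positivity)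
  have e0 : (vec2 1 0) 0 = 1 ∧ (vec2 1 0) 1 = 0 ∧ (vec2 (1 / 2) (Real.sqrt 3 / 2)) 0 = 1 / 2 ∧
      (vec2 (1 / 2) (Real.sqrt 3 / 2)) 1 = Real.sqrt 3 / 2 := by simp [vec2]
  obtain ⟨e1, e2, e3, e4⟩ := e0
  simp only [PiLp.smul_apply, smul_eq_mul, e1, e2, e3, e4, mul_pow, hc]
  have hA : Real.sqrt 3 / 2 * (2 / Real.sqrt 3 * 1 ^ 2 + 2 / Real.sqrt 3 * 0 ^ 2) = 1 := by
    field_simp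
    norm_num
  have hB : Real.sqrt 3 * (Real.sqrt (2 / Real.sqrt 3) * 1 * (Real.sqrt (2 / Real.sqrt 3) *
      (1 / 2)) + Real.sqrt (2 / Real.sqrt 3) * 0 * (Real.sqrt (2 / Real.sqrt 3) *
        (Real.sqrt 3 / 2))) = 1 := by
    linear_combination Real.sqrt 3 / 2 * hc + hA
  have hD : Real.sqrt 3 / 2 * (2 / Real.sqrt 3 * (1 / 2) ^ 2 +
      2 / Real.sqrt 3 * (Real.sqrt 3 / 2) ^ 2) = 1 := by
    rw [div_pow (Real.sqrt 3), h3]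
    field_simp
    norm_num
  rw [hA, hB, hD]

/-- Among lattices of co-volume `1`, the triangular lattice minimizes the Epstein zeta function. -/
theorem epsteinZeta_triangularLattice_le {L : Set (EuclideanSpace ℝ (Fin 2))}
    (hL : IsLattice2OfCovol L 1) {s : ℝ} (hs : 2 < s) :
    epsteinZeta triangularLattice s ≤ epsteinZeta L s := by
  obtain ⟨A, B, D, hA, hdisc, hζ, -⟩ := hL.exists_form
  rw [hζ, epsteinZeta_triangularLattice]
  exact mul_le_mul_of_nonneg_left (tsum_quadForm_one_rpow_le hA hdisc (by linarith))
    (by positivity)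

theorem LJenergy_smul {c : ℝ} (hc : 0 < c) (a b α β : ℝ) (L : Set (EuclideanSpace ℝ (Fin 2))) :
    LJenergy a b α β (c • L) = LJenergy (a * c ^ (-α)) (b * c ^ (-β)) α β L := by
  have h := tsum_image_diff_zero (smul_right_injective (EuclideanSpace ℝ (Fin 2)) hc.ne')
    (smul_zero c) L fun x => a * ‖x‖ ^ (-α) - b * ‖x‖ ^ (-β)
  simp_rw [norm_smul, Real.norm_of_nonneg hc.le, Real.mul_rpow hc.le (norm_nonneg _),
    ← mul_assoc] at h
  exact h

theorem IsRotationOf.LJenergy_eq {L L' : Set (EuclideanSpace ℝ (Fin 2))} (h : IsRotationOf L L')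
    (a b α β : ℝ) : LJenergy a b α β L = LJenergy a b α β L' := by
  obtain ⟨O, rfl⟩ := h
  have h := tsum_image_diff_zero O.injective (map_zero O) L'
    fun x => a * ‖x‖ ^ (-α) - b * ‖x‖ ^ (-β)
  simp_rw [O.norm_map] at h
  exact h

theorem isRotationOf_smul_iff {c : ℝ} (hc : c ≠ 0) {L L' : Set (EuclideanSpace ℝ (Fin 2))} :
    IsRotationOf (c • L) (c • L') ↔ IsRotationOf L L' := by
  unfold IsRotationOf
  simp_rw [image_smul_set]
  refine exists_congr fun O => ⟨fun h => ?_, fun h => by rw [h]⟩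
  rw [← inv_smul_smul₀ hc L, h, inv_smul_smul₀ hc]

theorem IsLattice2OfCovol.exists_unit {L : Set (EuclideanSpace ℝ (Fin 2))} {V : ℝ} (hV : 0 < V)
    (hL : IsLattice2OfCovol L V) :
    ∃ L', IsLattice2OfCovol L' 1 ∧ L = Real.sqrt V • L' := by
  obtain ⟨u, v, hdet, habs, rfl⟩ := hL
  have hs : Real.sqrt V ≠ 0 := (Real.sqrt_pos.2 hV).ne'
  have hd : det2 ((Real.sqrt V)⁻¹ • u) ((Real.sqrt V)⁻¹ • v) = V⁻¹ * det2 u v := by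
    rw [det2_smul_smul, inv_pow, Real.sq_sqrt hV.le]
  refine ⟨_, ⟨_, _, ?_, ?_, rfl⟩, (by rw [← smul_latticeSet, smul_inv_smul₀ hs] :
    latticeSet u v = Real.sqrt V •
      latticeSet ((Real.sqrt V)⁻¹ • u) ((Real.sqrt V)⁻¹ • v))⟩
  · rw [hd]
    exact mul_ne_zero (inv_ne_zero hV.ne') hdet
  · rw [hd, abs_mul, habs, abs_of_pos (inv_pos.2 hV), inv_mul_cancel₀ hV.ne']

theorem weight_quotient_le {a b α β V : ℝ} (hβ : 2 < β) (hαβ : β < α) (ha : 0 < a) (hb : 0 < b)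
    (hV : 0 < V) (hVle : V ≤ (a * α / (b * β)) ^ (2 / (α - β))) :
    b * Real.sqrt V ^ (-β) ≤ α / β * (a * Real.sqrt V ^ (-α)) := by
  have hs := Real.sqrt_pos.2 hV
  have hβ0 : 0 < β := by linarith
  have hα0 : 0 < α := by linarith
  have hd : 0 < α - β := by linarith
  have hT : 0 < a * α / (b * β) := by positivity
  have h1 : Real.sqrt V ^ (α - β) ≤ a * α / (b * β) := by
    calc Real.sqrt V ^ (α - β) = V ^ ((α - β) / 2) := by
          rw [Real.sqrt_eq_rpow, ← Real.rpow_mul hV.le]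
          congr 1
          ring
      _ ≤ ((a * α / (b * β)) ^ (2 / (α - β))) ^ ((α - β) / 2) :=
          Real.rpow_le_rpow hV.le hVle (by positivity)
      _ = a * α / (b * β) := by
          rw [← Real.rpow_mul hT.le, div_mul_div_cancel₀ hd.ne', div_self two_ne_zero,
            Real.rpow_one]
  have h2 : Real.sqrt V ^ (-β) = Real.sqrt V ^ (α - β) * Real.sqrt V ^ (-α) := by
    rw [← Real.rpow_add hs]
    congr 1
    ring
  have h3 := Real.rpow_pos_of_pos hs (-α)
  calc b * Real.sqrt V ^ (-β) = Real.sqrt V ^ (α - β) * (b * Real.sqrt V ^ (-α)) := by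
        rw [h2]
        ring
    _ ≤ a * α / (b * β) * (b * Real.sqrt V ^ (-α)) := by gcongr
    _ = α / β * (a * Real.sqrt V ^ (-α)) := by field_simp

/-- If `ζ_L(α) - ζ_{A₂}(α) > (α/β)(ζ_L(β) - ζ_{A₂}(β))` for every unit co-volume lattice `L`
not a rotation of `A₂`, then for all `a, b > 0` and `0 < V ≤ (aα/(bβ))^{2/(α-β)}`, the
triangular lattice `√V·A₂` is the unique minimizer of `E_f`, up to rotation, among lattices
of co-volume `V`. -/
theorem quotient_bound_implies_fixed_density_minimality
    (α β : ℝ) (hβ : 2 < β) (hαβ : β < α)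
    (hQ : ∀ L : Set (EuclideanSpace ℝ (Fin 2)), IsLattice2OfCovol L 1 →
      ¬ IsRotationOf L triangularLattice →
      epsteinZeta L α - epsteinZeta triangularLattice α >
        (α / β) * (epsteinZeta L β - epsteinZeta triangularLattice β)) :
    ∀ a b : ℝ, 0 < a → 0 < b → ∀ V : ℝ, 0 < V → V ≤ (a * α / (b * β)) ^ (2 / (α - β)) →
      ∀ L : Set (EuclideanSpace ℝ (Fin 2)), IsLattice2OfCovol L V →
        LJenergy a b α β (Real.sqrt V • triangularLattice) ≤ LJenergy a b α β L ∧
        (LJenergy a b α β L = LJenergy a b α β (Real.sqrt V • triangularLattice) ↔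
          IsRotationOf L (Real.sqrt V • triangularLattice)) := by
  intro a b ha hb V hV hVle L hL
  obtain ⟨L', hL', rfl⟩ := hL.exists_unit hV
  have hs := Real.sqrt_pos.2 hV
  have hα : 2 < α := hβ.trans hαβ
  rw [isRotationOf_smul_iff hs.ne']
  by_cases hrot : IsRotationOf L' triangularLattice
  · have h := ((isRotationOf_smul_iff hs.ne').2 hrot).LJenergy_eq a b α β
    exact ⟨h.ge, iff_of_true h hrot⟩
  suffices h : LJenergy a b α β (Real.sqrt V • triangularLattice) <
      LJenergy a b α β (Real.sqrt V • L') from ⟨h.le, iff_of_false h.ne' hrot⟩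
  obtain ⟨-, -, -, -, -, -, hE⟩ := hL'.exists_form
  obtain ⟨-, -, -, -, -, -, hE₂⟩ := isLattice2OfCovol_triangularLattice.exists_form
  rw [LJenergy_smul hs, LJenergy_smul hs, hE _ _ _ _ hα hβ, hE₂ _ _ _ _ hα hβ]
  have hw := weight_quotient_le hβ hαβ ha hb hV hVle
  have hx : 0 < a * Real.sqrt V ^ (-α) := by positivity
  have hy : 0 < b * Real.sqrt V ^ (-β) := by positivity
  have hmin := epsteinZeta_triangularLattice_le hL' hα
  have hq := hQ L' hL' hrot
  have hr : 0 < α / β := div_pos (by linarith) (by linarith)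
  generalize a * Real.sqrt V ^ (-α) = x at *
  generalize b * Real.sqrt V ^ (-β) = y at *
  generalize α / β = r at *
  rcases lt_or_ge 0 (epsteinZeta L' β - epsteinZeta triangularLattice β) with hβpos | hβneg
  · have h1 := mul_lt_mul_of_pos_left hq hx
    have h2 := mul_le_mul_of_nonneg_right hw hβpos.le
    linarith
  · have h1 := mul_nonneg hx.le (sub_nonneg.2 hmin)
    have h2 := mul_nonpos_of_nonneg_of_nonpos hy.le hβneg
    rcases hβneg.lt_or_eq with h | h
    · have h3 := mul_neg_of_pos_of_neg hy h
      linarith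
    · rw [h, mul_zero] at hq
      have h3 := mul_pos hx hq
      linarith
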